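/- Let w = (w_n)_{n≥1} be a bounded sequence of positive real numbers that does not converge to 0, and let B_w : c₀(ℕ) → c₀(ℕ) be the weighted backward shift, (B_w x)_n = w_{n+1} x_{n+1}. Then B_w is not a compact operator, yet for every m ≥ 1 one has inf{r > 0 : B_w(B_{c₀}) ⊆ r·B_{c₀} + E_m} ≤ 2^{−m}, where E_m = {z ∈ c₀(ℕ) : Σ_n |z_n|^m < ∞} and B_{c₀} is the closed unit ball of c₀(ℕ); in particular these generalized Kolmogorov numbers of B_w with respect to the approximation scheme (E_m) tend to 0 while B_w is non-compact. -/

import Mathlib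

open ZeroAtInfty Metric Pointwise Filter

/-- The generalized approximation scheme `E_m = {z ∈ c₀ : ∑ |z_n|^m < ∞}` on `c₀(ℕ)`. -/
def Em (m : ℕ) : Set C₀(ℕ, ℝ) := {z : C₀(ℕ, ℝ) | Summable fun n => |z n| ^ m}

/-- A finitely supported sequence, as an element of `c₀`. -/
def finsuppToZeroAtInfty (f : ℕ →₀ ℝ) : C₀(ℕ, ℝ) where
  toFun := f
  continuous_toFun := continuous_of_discreteTopology
  zero_at_infty' := by
    rw [cocompact_eq_cofinite]
    refine tendsto_const_nhds.congr' ?_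
    filter_upwards [f.hasFiniteSupport.compl_mem_cofinite] with n hn
    exact (Function.notMem_support.mp hn).symm

@[simp]
theorem finsuppToZeroAtInfty_apply (f : ℕ →₀ ℝ) (n : ℕ) : finsuppToZeroAtInfty f n = f n := rfl

theorem ZeroAtInftyContinuousMap.norm_le_iff_of_nonneg {f : C₀(ℕ, ℝ)} {r : ℝ} (hr : 0 ≤ r) :
    ‖f‖ ≤ r ↔ ∀ n, |f n| ≤ r := by
  rw [← ZeroAtInftyContinuousMap.norm_toBCF_eq_norm, BoundedContinuousFunction.norm_le hr]
  rfl

theorem ZeroAtInftyContinuousMap.abs_apply_le_norm (f : C₀(ℕ, ℝ)) (n : ℕ) : |f n| ≤ ‖f‖ :=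
  (ZeroAtInftyContinuousMap.norm_le_iff_of_nonneg (norm_nonneg f)).mp le_rfl n

theorem finsuppToZeroAtInfty_mem_Em (f : ℕ →₀ ℝ) {m : ℕ} (hm : 1 ≤ m) :
    finsuppToZeroAtInfty f ∈ Em m := by
  refine summable_of_ne_finset_zero (s := f.support) fun n hn => ?_
  simp [Finsupp.notMem_support_iff.mp hn, Nat.one_le_iff_ne_zero.mp hm]

/-- Finitely supported sequences are dense in `c₀`, so `Em m` approximates to any precision. -/
theorem mem_smul_closedBall_add_Em (z : C₀(ℕ, ℝ)) {r : ℝ} (hr : 0 < r) {m : ℕ} (hm : 1 ≤ m) :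
    z ∈ r • closedBall (0 : C₀(ℕ, ℝ)) 1 + Em m := by
  have hz : Tendsto z cofinite (nhds 0) := by
    rw [← cocompact_eq_cofinite]
    exact z.zero_at_infty'
  have hfin : {n | ¬ |z n| < r}.Finite := by
    simpa [Real.dist_eq] using Metric.tendsto_nhds.mp hz r hr
  let f : ℕ →₀ ℝ := Finsupp.onFinset hfin.toFinset (fun n => if |z n| < r then 0 else z n)
    fun n hn => by
      rw [Set.Finite.mem_toFinset]
      intro h
      exact hn (if_pos h)
  refine Set.mem_add.mpr ⟨z - finsuppToZeroAtInfty f, ?_, finsuppToZeroAtInfty f,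
    finsuppToZeroAtInfty_mem_Em f hm, sub_add_cancel _ _⟩
  rw [_root_.smul_closedBall _ _ zero_le_one, smul_zero, mem_closedBall_zero_iff, mul_one,
    Real.norm_of_nonneg hr.le, ZeroAtInftyContinuousMap.norm_le_iff_of_nonneg hr.le]
  intro n
  by_cases h : |z n| < r
  · simpa [f, h] using h.le
  · simpa [f, h] using hr.le

theorem not_isCompactOperator_of_weighted_backward_shift
    (w : ℕ → ℝ) (hw_not_null : ¬ Tendsto w atTop (nhds 0))
    (B : C₀(ℕ, ℝ) →L[ℝ] C₀(ℕ, ℝ))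
    (hB : ∀ (x : C₀(ℕ, ℝ)) (n : ℕ), (B x) n = w (n + 1) * x (n + 1)) :
    ¬ IsCompactOperator (⇑B) := by
  intro hcomp
  obtain ⟨ε, hε, hfreq⟩ : ∃ ε > 0, ∃ᶠ n in atTop, ε ≤ |w (n + 1)| := by
    rw [← tendsto_add_atTop_iff_nat 1, Metric.tendsto_nhds] at hw_not_null
    simpa [Real.dist_eq, Filter.Frequently] using hw_not_null
  obtain ⟨φ, hφ, hwφ⟩ := extraction_of_frequently_atTop hfreq
  let e : ℕ → C₀(ℕ, ℝ) := fun n => finsuppToZeroAtInfty (Finsupp.single (n + 1) 1)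
  have he : ∀ n, e n ∈ closedBall (0 : C₀(ℕ, ℝ)) 1 := fun n => by
    rw [mem_closedBall_zero_iff, ZeroAtInftyContinuousMap.norm_le_iff_of_nonneg zero_le_one]
    intro k
    by_cases h : n + 1 = k <;> simp [e, h]
  obtain ⟨y, -, ψ, hψ, hy⟩ := (IsCompactOperator.isCompact_closure_image_closedBall (f := B.toLinearMap) hcomp 1).tendsto_subseq
    (x := fun k => B (e (φ k))) fun k => subset_closure (Set.mem_image_of_mem _ (he _))
  have hcoord : ∀ j, y j = 0 := fun j => by
    have hlim : Tendsto (fun k => B (e (φ (ψ k))) j) atTop (nhds (y j)) := by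
      rw [tendsto_iff_norm_sub_tendsto_zero] at hy ⊢
      exact squeeze_zero (fun _ => norm_nonneg _)
        (fun k => (B (e (φ (ψ k))) - y).abs_apply_le_norm j) hy
    refine tendsto_nhds_unique hlim (tendsto_const_nhds.congr' ?_)
    filter_upwards [(hφ.comp hψ).tendsto_atTop.eventually_gt_atTop j] with k hk
    simp [hB, e, (show j < φ (ψ k) from hk).ne']
  have hy0 : y = 0 := by
    ext j
    exact hcoord j
  have hnorm : ∀ k, ε ≤ ‖B (e (φ (ψ k)))‖ := fun k =>
    (hwφ (ψ k)).trans <| by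
      simpa [hB, e] using (B (e (φ (ψ k)))).abs_apply_le_norm (φ (ψ k))
  have hle : ε ≤ ‖y‖ := ge_of_tendsto' hy.norm hnorm
  rw [hy0, norm_zero] at hle
  exact hle.not_gt hε

theorem weighted_backward_shift_noncompact_but_Q_compact
    (w : ℕ → ℝ) (hw_pos : ∀ n, 1 ≤ n → 0 < w n) (hw_bdd : BddAbove (Set.range w))
    (hw_not_null : ¬ Tendsto w atTop (nhds 0))
    (B : C₀(ℕ, ℝ) →L[ℝ] C₀(ℕ, ℝ))
    (hB : ∀ (x : C₀(ℕ, ℝ)) (n : ℕ), (B x) n = w (n + 1) * x (n + 1)) :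
    ¬ IsCompactOperator (⇑B) ∧
    ∀ m : ℕ, 1 ≤ m →
      sInf {r : ℝ | 0 < r ∧
          B '' closedBall 0 1 ⊆ r • closedBall (0 : C₀(ℕ, ℝ)) 1 + Em m}
        ≤ ((1 : ℝ) / 2) ^ m := by
  refine ⟨not_isCompactOperator_of_weighted_backward_shift w hw_not_null B hB, fun m hm => ?_⟩
  have hr : (0 : ℝ) < (1 / 2) ^ m := by positivity
  exact csInf_le ⟨0, fun r h => h.1.le⟩ ⟨hr, fun z _ => mem_smul_closedBall_add_Em z hr hm⟩
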